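/- Let n ∈ ℕ, P = {0, 1, …, n}, P⁺ = P ∪ {∞}, fix positive integer weights a, b, let K be a field, and let I = ⊕_{s∈S} I_s and M = ⊕_{t∈T} M_t be finite direct sums of convex representations of P. Define D(I,M) = min{ε ∈ ℕ : there exists a (Λ_ε, Λ_ε)-interleaving between I and M} and D_B(I,M) = min{ε ∈ ℕ : there exists an ε-matching between I and M} (both sets are nonempty, so the minima exist). Then D(I,M) = D_B(I,M); that is, the identity is an isometry between the interleaving distance and the bottleneck distance on finite direct sums of convex representations of a finite totally ordered set. -/

import Mathlib

namespace GPM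

/-- A translation on a preorder: a monotone map `Λ` with `x ≤ Λ x` for all `x`. -/
structure Translation (Q : Type*) [Preorder Q] where
  toFun : Q → Q
  mono : Monotone toFun
  le_apply : ∀ x, x ≤ toFun x

/-- A representation of a poset `P` with values in `K`-vector spaces. -/
structure Rep (P : Type*) [Preorder P] (K : Type*) [Field K] where
  V : P → Type*
  [addCommGroup : ∀ p, AddCommGroup (V p)]
  [module : ∀ p, Module K (V p)]
  map : ∀ {p q : P}, p ≤ q → V p →ₗ[K] V q
  map_refl : ∀ p : P, map (le_refl p) = LinearMap.id
  map_comp : ∀ {p q r : P} (hpq : p ≤ q) (hqr : q ≤ r),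
      (map hqr).comp (map hpq) = map (hpq.trans hqr)

attribute [instance] Rep.addCommGroup Rep.module

/-- A morphism of representations (a natural transformation). -/
structure RepHom {P : Type*} [Preorder P] {K : Type*} [Field K] (M N : Rep P K) where
  app : ∀ p, M.V p →ₗ[K] N.V p
  natural : ∀ {p q : P} (h : p ≤ q), (N.map h).comp (app p) = (app q).comp (M.map h)

/-- The shift `MΛ : p ↦ M(Λ p)` of a representation by a translation. -/
def Rep.shift {P : Type*} [Preorder P] {K : Type*} [Field K]
    (M : Rep P K) (Λ : Translation P) : Rep P K where
  V p := M.V (Λ.toFun p)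
  map h := M.map (Λ.mono h)
  map_refl p := M.map_refl (Λ.toFun p)
  map_comp h1 h2 := M.map_comp (Λ.mono h1) (Λ.mono h2)

/-- `(φ, ψ)` is a `(Λ, Γ)`-interleaving between `F` and `G`: `φ : F → GΛ`, `ψ : G → FΓ`,
`ψΛ ∘ φ` is the canonical morphism `F → FΓΛ` and `φΓ ∘ ψ` is the canonical morphism
`G → GΛΓ`. -/
def IsInterleaving {P : Type*} [Preorder P] {K : Type*} [Field K]
    (Λ Γ : Translation P) (F G : Rep P K)
    (φ : RepHom F (G.shift Λ)) (ψ : RepHom G (F.shift Γ)) : Prop :=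
  (∀ p, (ψ.app (Λ.toFun p)).comp (φ.app p)
      = F.map ((Λ.le_apply p).trans (Γ.le_apply (Λ.toFun p)))) ∧
  (∀ p, (φ.app (Γ.toFun p)).comp (ψ.app p)
      = G.map ((Γ.le_apply p).trans (Λ.le_apply (Γ.toFun p))))

/-- `F` and `G` are `(Λ, Γ)`-interleaved. -/
def Interleaved {P : Type*} [Preorder P] {K : Type*} [Field K]
    (Λ Γ : Translation P) (F G : Rep P K) : Prop :=
  ∃ φ ψ, IsInterleaving Λ Γ F G φ ψ

/-- The submodule of `K` underlying the convex representation of `S` at the point `p`: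
all of `K` on `S`, and `0` off `S`. -/
noncomputable def convexSub (K : Type*) [Field K] {Q : Type*} (S : Set Q) (p : Q) :
    Submodule K K :=
  @ite _ (p ∈ S) (Classical.dec _) ⊤ ⊥

theorem convexSub_pos (K : Type*) [Field K] {Q : Type*} {S : Set Q} {p : Q} (h : p ∈ S) :
    convexSub K S p = ⊤ := by
  rw [convexSub, if_pos h]

theorem convexSub_neg (K : Type*) [Field K] {Q : Type*} {S : Set Q} {p : Q} (h : p ∉ S) :
    convexSub K S p = ⊥ := by
  rw [convexSub, if_neg h]

/-- The canonical map between the fibers of the convex representations of `S` and `T`: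
the identity of `K` when both fibers are `K`, and zero otherwise. -/
noncomputable def phiMap (K : Type*) [Field K] {Q : Type*} (S T : Set Q) (p q : Q) :
    ↥(convexSub K S p) →ₗ[K] ↥(convexSub K T q) :=
  @dite _ (p ∈ S ∧ q ∈ T) (Classical.dec _)
    (fun h => Submodule.inclusion (le_of_eq (by rw [convexSub_pos K h.1, convexSub_pos K h.2])))
    (fun _ => 0)

theorem phiMap_neg (K : Type*) [Field K] {Q : Type*} {S T : Set Q} {p q : Q}
    (h : ¬(p ∈ S ∧ q ∈ T)) : phiMap K S T p q = 0 := by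
  rw [phiMap, dif_neg h]

/-- The convex representation with support the interval-convex set `S`:
`K` at points of `S`, `0` elsewhere, with identity structure maps inside `S`. -/
noncomputable def convexRep (K : Type*) [Field K] {Q : Type*} [Preorder Q]
    (S : Set Q) (hS : S.OrdConnected) : Rep Q K where
  V p := ↥(convexSub K S p)
  map {p q} _ := phiMap K S S p q
  map_refl p := by
    show phiMap K S S p p = LinearMap.id
    by_cases hp : p ∈ S
    · rw [phiMap, dif_pos ⟨hp, hp⟩]
      rfl
    · rw [phiMap_neg (K := K) (by tauto)]
      apply LinearMap.ext
      intro x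
      have hx : x = 0 := by
        apply Subtype.ext
        have hle : convexSub K S p ≤ ⊥ := le_of_eq (convexSub_neg K hp)
        simpa using hle x.2
      simp [hx]
  map_comp {p q r} hpq hqr := by
    show (phiMap K S S q r).comp (phiMap K S S p q) = phiMap K S S p r
    by_cases hp : p ∈ S
    · by_cases hr : r ∈ S
      · have hq : q ∈ S := hS.out hp hr ⟨hpq, hqr⟩
        rw [phiMap, phiMap, phiMap, dif_pos ⟨hq, hr⟩, dif_pos ⟨hp, hq⟩, dif_pos ⟨hp, hr⟩]
        rfl
      · rw [phiMap_neg (K := K) (S := S) (T := S) (p := q) (q := r) (by tauto),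
          phiMap_neg (K := K) (S := S) (T := S) (p := p) (q := r) (by tauto)]
        simp
    · rw [phiMap_neg (K := K) (S := S) (T := S) (p := p) (q := q) (by tauto),
        phiMap_neg (K := K) (S := S) (T := S) (p := p) (q := r) (by tauto)]
      simp

/-- Direct sum of a (finite) family of representations. -/
def Rep.dfsum {P : Type*} [Preorder P] {K : Type*} [Field K]
    {ι : Type*} (X : ι → Rep P K) : Rep P K where
  V p := ∀ i, (X i).V p
  map h := LinearMap.pi fun i => ((X i).map h).comp (LinearMap.proj i)
  map_refl p := by
    apply LinearMap.ext
    intro x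
    funext i
    simp [(X i).map_refl]
  map_comp h1 h2 := by
    apply LinearMap.ext
    intro x
    funext i
    have := congrArg (fun f => f (x i)) ((X i).map_comp h1 h2)
    simp only [LinearMap.comp_apply] at this
    simpa using this

/-- The maximal translation `Λ_ε` of height `ε` on `P⁺ = {0, …, n} ∪ {∞}`,
for the weights `(a, b)`:  `Λ_ε ∞ = ∞`, and for `x ∈ P`, `Λ_ε x = ∞` if
`a(n−x)+b ≤ ε` and `Λ_ε x = min n (x + ⌊ε/a⌋)` otherwise. -/
def lamFun (n a b ε : ℕ) : WithTop (Fin (n + 1)) → WithTop (Fin (n + 1)) :=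
  WithTop.recTopCoe ⊤ fun x =>
    if a * (n - (x : ℕ)) + b ≤ ε then ⊤
    else (↑(⟨min n ((x : ℕ) + ε / a), by omega⟩ : Fin (n + 1)) : WithTop (Fin (n + 1)))

theorem lamFun_coe (n a b ε : ℕ) (x : Fin (n + 1)) :
    lamFun n a b ε (↑x) =
      if a * (n - (x : ℕ)) + b ≤ ε then ⊤
      else (↑(⟨min n ((x : ℕ) + ε / a), by omega⟩ : Fin (n + 1)) : WithTop (Fin (n + 1))) := rfl

theorem lamFun_le (n a b ε : ℕ) : ∀ x, x ≤ lamFun n a b ε x := by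
  intro x
  induction x using WithTop.recTopCoe with
  | top => exact le_refl _
  | coe x =>
      rw [lamFun_coe]
      by_cases h : a * (n - (x : ℕ)) + b ≤ ε
      · rw [if_pos h]
        exact le_top
      · rw [if_neg h]
        apply WithTop.coe_le_coe.mpr
        rw [Fin.le_def]
        have hx : (x : ℕ) < n + 1 := x.2
        exact le_min (Nat.le_of_lt_succ hx) (Nat.le_add_right _ _)

theorem lamFun_mono (n a b ε : ℕ) : Monotone (lamFun n a b ε) := by
  intro x y hxy
  induction x using WithTop.recTopCoe with
  | top =>
      have : y = ⊤ := top_le_iff.mp hxy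
      subst this
      exact le_refl _
  | coe x =>
      induction y using WithTop.recTopCoe with
      | top => exact le_top
      | coe y =>
          have hxy' : (x : ℕ) ≤ (y : ℕ) := by exact_mod_cast WithTop.coe_le_coe.mp hxy
          rw [lamFun_coe, lamFun_coe]
          by_cases h2 : a * (n - (y : ℕ)) + b ≤ ε
          · rw [if_pos h2]
            exact le_top
          · have h1 : ¬ a * (n - (x : ℕ)) + b ≤ ε := by
              intro h1
              apply h2
              calc a * (n - (y : ℕ)) + b ≤ a * (n - (x : ℕ)) + b := by
                    gcongr
                _ ≤ ε := h1
            rw [if_neg h1, if_neg h2]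
            apply WithTop.coe_le_coe.mpr
            rw [Fin.le_def]
            exact min_le_min (le_refl n) (Nat.add_le_add_right hxy' _)

/-- The maximal translation of height `ε` packaged as a `Translation`. -/
def lamTrans (n a b ε : ℕ) : Translation (WithTop (Fin (n + 1))) :=
  ⟨lamFun n a b ε, lamFun_mono n a b ε, lamFun_le n a b ε⟩

/-- The convex representation of `{0, …, n}` with support the interval `[x, X]`,
regarded as a representation of `P⁺` which is zero at `∞`. -/
noncomputable def intervalRep (n : ℕ) (K : Type*) [Field K] (x X : Fin (n + 1)) :
    Rep (WithTop (Fin (n + 1))) K :=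
  convexRep K (Set.Icc (↑x) (↑X)) Set.ordConnected_Icc

/-- The width of the convex representation with support `[x, X] ⊆ {0, …, n}`:
the least `ε` with `Λ_ε(Λ_ε x) > X` in `P⁺`. -/
noncomputable def width (n a b : ℕ) (x X : Fin (n + 1)) : ℕ :=
  sInf {ε : ℕ | (↑X : WithTop (Fin (n + 1))) < lamFun n a b ε (lamFun n a b ε ↑x)}

/-- An `ε`-matching between the direct sums of the convex representations with supports
`[lo s, hi s]` (`s ∈ ι`) and `[lo' t, hi' t]` (`t ∈ κ`): a bijection between subsets
`S' ⊆ ι` and `T' ⊆ κ` containing all indices of width `> ε`, matched summands being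
`(Λ_ε, Λ_ε)`-interleaved. -/
def IsMatching (n a b ε : ℕ) (K : Type*) [Field K] {ι κ : Type*}
    (lo hi : ι → Fin (n + 1)) (lo' hi' : κ → Fin (n + 1)) : Prop :=
  ∃ (S' : Set ι) (T' : Set κ) (f : S' → T'),
    Function.Bijective f ∧
    (∀ s : ι, ε < width n a b (lo s) (hi s) → s ∈ S') ∧
    (∀ t : κ, ε < width n a b (lo' t) (hi' t) → t ∈ T') ∧
    (∀ s : S', Interleaved (lamTrans n a b ε) (lamTrans n a b ε)
        (intervalRep n K (lo s.1) (hi s.1)) (intervalRep n K (lo' (f s).1) (hi' (f s).1)))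

section BarHom

variable {Q : Type*} [LinearOrder Q] {K : Type*} [Field K] {ι κ : Type*}

/-- The convex representation supported on the closed interval `[x, X]`. -/
noncomputable abbrev barRep (K : Type*) [Field K] {Q : Type*} [LinearOrder Q] (x X : Q) :
    Rep Q K :=
  convexRep K (Set.Icc x X) Set.ordConnected_Icc

theorem eq_zero_of_notMem {Q : Type*} {S : Set Q} {p : Q} (hp : p ∉ S)
    (v : convexSub K S p) : v = 0 := by
  apply Subtype.ext
  simpa using (le_of_eq (convexSub_neg K hp)) v.2

theorem coe_phiMap {Q : Type*} (S T : Set Q) (p q : Q) [Decidable (q ∈ T)]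
    (v : convexSub K S p) :
    (phiMap K S T p q v : K) = if q ∈ T then (v : K) else 0 := by
  by_cases hq : q ∈ T
  · by_cases hp : p ∈ S
    · rw [phiMap, dif_pos ⟨hp, hq⟩, if_pos hq]
      rfl
    · rw [phiMap_neg K (by tauto), eq_zero_of_notMem hp v]
      simp
  · rw [phiMap_neg K (by tauto), if_neg hq]
    simp

/-- The generator of the convex representation supported on `[x, X]`. -/
noncomputable def barGen (K : Type*) [Field K] {Q : Type*} [LinearOrder Q] {x X : Q}
    (h : x ≤ X) : convexSub K (Set.Icc x X) x :=
  ⟨1, by rw [convexSub_pos K (Set.left_mem_Icc.2 h)]; trivial⟩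

open Classical in
/-- The scalar by which a morphism between sums of interval representations sends the generator
of the summand `i` to the summand `j`. -/
noncomputable def RepHom.coeff {Λ : Translation Q} {lo hi : ι → Q} {lo' hi' : κ → Q}
    (hlo : ∀ i, lo i ≤ hi i)
    (f : RepHom (Rep.dfsum fun i => barRep K (lo i) (hi i))
      ((Rep.dfsum fun j => barRep K (lo' j) (hi' j)).shift Λ)) (i : ι) (j : κ) : K :=
  Subtype.val (p := fun v => v ∈ convexSub K (Set.Icc (lo' j) (hi' j)) (Λ.toFun (lo i)))
    (f.app (lo i) (Pi.single (M := fun i' => convexSub K (Set.Icc (lo i') (hi i')) (lo i))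
      i (barGen K (hlo i))) j)

variable {Λ : Translation Q} {lo hi : ι → Q} {lo' hi' : κ → Q} (hlo : ∀ i, lo i ≤ hi i)
  (f : RepHom (Rep.dfsum fun i => barRep K (lo i) (hi i))
      ((Rep.dfsum fun j => barRep K (lo' j) (hi' j)).shift Λ))

theorem RepHom.mem_Icc_of_coeff_ne_zero {i : ι} {j : κ} (h : f.coeff hlo i j ≠ 0) :
    Λ.toFun (lo i) ∈ Set.Icc (lo' j) (hi' j) := by
  by_contra hn
  apply h
  rw [RepHom.coeff]
  exact congrArg Subtype.val (eq_zero_of_notMem (K := K) hn _)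

open Classical in
theorem RepHom.coe_app_map_single {i : ι} {q : Q} (hq : lo i ≤ q) (j : κ) :
    Subtype.val (p := fun v => v ∈ convexSub K (Set.Icc (lo' j) (hi' j)) (Λ.toFun q))
      (f.app q (Pi.single (M := fun i' => convexSub K (Set.Icc (lo i') (hi i')) q)
        i (phiMap K _ _ (lo i) q (barGen K (hlo i)))) j) =
      if Λ.toFun q ≤ hi' j then f.coeff hlo i j else 0 := by
  have key := congrArg (fun g => g (Pi.single
    (M := fun i' => convexSub K (Set.Icc (lo i') (hi i')) (lo i)) i (barGen K (hlo i))) j)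
    (f.natural hq)
  have e1 : (Rep.dfsum fun i => barRep K (lo i) (hi i)).map hq
      (Pi.single (M := fun i' => convexSub K (Set.Icc (lo i') (hi i')) (lo i))
        i (barGen K (hlo i))) =
      Pi.single (M := fun i' => convexSub K (Set.Icc (lo i') (hi i')) q)
        i (phiMap K _ _ (lo i) q (barGen K (hlo i))) := by
    funext i'
    change phiMap K _ _ (lo i) q (Pi.single
      (M := fun i' => convexSub K (Set.Icc (lo i') (hi i')) (lo i)) i (barGen K (hlo i)) i') = _
    by_cases hii : i' = i
    · subst hii
      simp
    · simp [Pi.single_eq_of_ne hii]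
  refine (congrArg (fun w => Subtype.val
    (p := fun v => v ∈ convexSub K (Set.Icc (lo' j) (hi' j)) (Λ.toFun q)) (f.app q w j))
    e1.symm).trans ((congrArg (Subtype.val
    (p := fun v => v ∈ convexSub K (Set.Icc (lo' j) (hi' j)) (Λ.toFun q))) key).symm.trans ?_)
  refine (coe_phiMap _ _ _ _ _).trans ?_
  change (if _ then f.coeff hlo i j else 0) = _
  by_cases hc : f.coeff hlo i j = 0
  · simp [hc]
  · have := f.mem_Icc_of_coeff_ne_zero hlo hc
    have h2 : lo' j ≤ Λ.toFun q := this.1.trans (Λ.mono hq)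
    simp [Set.mem_Icc, h2]

theorem RepHom.hi_lt_of_coeff_ne_zero {i : ι} {j : κ} (h : f.coeff hlo i j ≠ 0) {q : Q}
    (hq : hi i < q) : hi' j < Λ.toFun q := by
  classical
  by_contra! hn
  have := f.coe_app_map_single hlo ((hlo i).trans hq.le) j
  rw [if_pos hn] at this
  apply h
  rw [← this, phiMap_neg K (by simp [hq]), LinearMap.zero_apply, Pi.single_zero]
  erw [map_zero]
  rfl

open Classical in
theorem RepHom.coe_app_eq_sum [Fintype ι] (q : Q)
    (w : ∀ i, convexSub K (Set.Icc (lo i) (hi i)) q) (j : κ) :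
    Subtype.val (p := fun v => v ∈ convexSub K (Set.Icc (lo' j) (hi' j)) (Λ.toFun q))
      (f.app q w j) =
      if Λ.toFun q ≤ hi' j then ∑ i, (w i : K) * f.coeff hlo i j else 0 := by
  let L : (∀ i, convexSub K (Set.Icc (lo i) (hi i)) q) →ₗ[K] K :=
    (Submodule.subtype (convexSub K (Set.Icc (lo' j) (hi' j)) (Λ.toFun q))).comp
      ((LinearMap.proj (φ := fun j => convexSub K (Set.Icc (lo' j) (hi' j)) (Λ.toFun q)) j).comp
        (f.app q))
  have hL : ∀ i, L (Pi.single i (w i)) =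
      if Λ.toFun q ≤ hi' j then (w i : K) * f.coeff hlo i j else 0 := by
    intro i
    by_cases hw : q ∈ Set.Icc (lo i) (hi i)
    · have e : w i = (w i : K) • phiMap K _ (Set.Icc (lo i) (hi i)) (lo i) q
          (barGen K (hlo i)) := by
        apply Subtype.ext
        rw [Submodule.coe_smul, coe_phiMap, if_pos hw]
        simp [barGen]
      have h2 : L (Pi.single i (phiMap K _ (Set.Icc (lo i) (hi i)) (lo i) q
          (barGen K (hlo i)))) = _ := f.coe_app_map_single hlo hw.1 j
      conv_lhs => rw [e, Pi.single_smul, map_smul, h2]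
      simp
    · rw [eq_zero_of_notMem hw (w i)]
      simp
  change L w = _
  rw [← Finset.univ_sum_single w, map_sum, Finset.sum_congr rfl fun i _ => hL i]
  split_ifs <;> simp

open Classical in
theorem IsInterleaving.sum_coeff_mul_coeff [Fintype κ] {Γ : Translation Q}
    (hlo' : ∀ j, lo' j ≤ hi' j)
    {g : RepHom (Rep.dfsum fun j => barRep K (lo' j) (hi' j))
      ((Rep.dfsum fun i => barRep K (lo i) (hi i)).shift Γ)}
    (h : IsInterleaving Λ Γ _ _ f g) {i i' : ι}
    (hle : Γ.toFun (Λ.toFun (lo i)) ≤ hi i') :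
    ∑ j, f.coeff hlo i j * g.coeff hlo' j i' = if i = i' then 1 else 0 := by
  set e := Pi.single (M := fun i' => convexSub K (Set.Icc (lo i') (hi i')) (lo i))
      i (barGen K (hlo i)) with he
  have h1 := g.coe_app_eq_sum hlo' (Λ.toFun (lo i)) (f.app (lo i) e) i'
  rw [if_pos hle] at h1
  have h2 := congrArg (Subtype.val
    (p := fun v => v ∈ convexSub K (Set.Icc (lo i') (hi i')) (Γ.toFun (Λ.toFun (lo i)))))
    (congrFun (LinearMap.congr_fun (h.1 (lo i)) e) i')
  refine Eq.trans ?_ ((h1.symm.trans h2).trans ?_)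
  · rfl
  · change Subtype.val (phiMap K _ _ _ _ (e i')) = _
    rw [coe_phiMap]
    by_cases hii : i = i'
    · subst hii
      have : Γ.toFun (Λ.toFun (lo i)) ∈ Set.Icc (lo i) (hi i) :=
        ⟨(Λ.le_apply _).trans (Γ.le_apply _), hle⟩
      simp [this, he, barGen]
    · simp [he, hii]

end BarHom

section Positions

variable (n a b : ℕ)

/-- The position of a point of `P⁺` on the line on which `Λ_ε` is, up to rounding down, the
translation by `ε`. -/
def pos : WithTop (Fin (n + 1)) → ℕ :=
  WithTop.recTopCoe (a * n + b) fun x => a * (x : ℕ)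

/-- The position of the successor in `P⁺` of a point of `P`. -/
noncomputable def death (X : Fin (n + 1)) : ℕ :=
  pos n a b (Order.succ (X : WithTop (Fin (n + 1))))

variable {n a b}

theorem pos_coe (x : Fin (n + 1)) : pos n a b x = a * (x : ℕ) := rfl

theorem pos_top : pos n a b ⊤ = a * n + b := rfl

theorem pos_strictMono (ha : 0 < a) (hb : 0 < b) : StrictMono (pos n a b) := by
  intro p q hpq
  induction p using WithTop.recTopCoe with
  | top => simp at hpq
  | coe x =>
    have hx : a * (x : ℕ) ≤ a * n := Nat.mul_le_mul_left a (Nat.le_of_lt_succ x.2)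
    induction q using WithTop.recTopCoe with
    | top => rw [pos_coe, pos_top]; omega
    | coe y =>
      rw [pos_coe, pos_coe]
      exact Nat.mul_lt_mul_of_pos_left (Fin.lt_def.1 (WithTop.coe_lt_coe.1 hpq)) ha

theorem le_lamFun_iff (ha : 0 < a) (hb : 0 < b) (ε : ℕ) (p q : WithTop (Fin (n + 1))) :
    q ≤ lamFun n a b ε p ↔ pos n a b q ≤ pos n a b p + ε := by
  induction p using WithTop.recTopCoe with
  | top =>
    have := (pos_strictMono (n := n) ha hb).monotone (le_top : q ≤ ⊤)
    exact ⟨fun _ => this.trans (Nat.le_add_right _ _), fun _ => le_top⟩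
  | coe x =>
    have hx : (x : ℕ) ≤ n := Nat.le_of_lt_succ x.2
    have hm : a * (n - (x : ℕ)) + a * x = a * n := by rw [← mul_add, Nat.sub_add_cancel hx]
    rw [lamFun_coe]
    split_ifs with h
    · have := (pos_strictMono (n := n) ha hb).monotone (le_top : q ≤ ⊤)
      rw [pos_top] at this
      rw [pos_coe]
      exact ⟨fun _ => by omega, fun _ => le_top⟩
    · induction q using WithTop.recTopCoe with
      | top =>
        rw [pos_coe, pos_top]
        refine ⟨fun h => absurd (top_le_iff.1 h) (WithTop.coe_ne_top), fun _ => by omega⟩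
      | coe y =>
        have hy : (y : ℕ) ≤ n := Nat.le_of_lt_succ y.2
        rw [pos_coe, pos_coe, WithTop.coe_le_coe, Fin.le_def]
        change (y : ℕ) ≤ min n _ ↔ _
        rw [le_min_iff, and_iff_right hy, ← Nat.sub_le_iff_le_add', Nat.le_div_iff_mul_le ha,
          Nat.sub_mul, Nat.sub_le_iff_le_add', mul_comm a, mul_comm a]

theorem pos_lt_death_iff (ha : 0 < a) (hb : 0 < b) (p : WithTop (Fin (n + 1)))
    (X : Fin (n + 1)) : pos n a b p < death n a b X ↔ p ≤ X := by
  rw [death, (pos_strictMono ha hb).lt_iff_lt, Order.lt_succ_iff_of_not_isMax]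
  simp

theorem lamFun_le_iff (ha : 0 < a) (hb : 0 < b) (ε : ℕ) (p : WithTop (Fin (n + 1)))
    (X : Fin (n + 1)) : lamFun n a b ε p ≤ X ↔ pos n a b p + ε < death n a b X := by
  have h : ¬ IsMax (X : WithTop (Fin (n + 1))) := by simp
  rw [← not_lt, ← Order.succ_le_iff_of_not_isMax h, le_lamFun_iff ha hb, not_le, death]

theorem lamFun_height_mono (ha : 0 < a) (hb : 0 < b) {ε δ : ℕ} (h : ε ≤ δ)
    (p : WithTop (Fin (n + 1))) : lamFun n a b ε p ≤ lamFun n a b δ p := by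
  rw [le_lamFun_iff ha hb]
  exact ((le_lamFun_iff ha hb ε p _).1 le_rfl).trans (by omega)

theorem lamFun_eq_top (ε : ℕ) (hε : a * n + b ≤ ε) (p : WithTop (Fin (n + 1))) :
    lamFun n a b ε p = ⊤ := by
  induction p using WithTop.recTopCoe with
  | top => rfl
  | coe x =>
    rw [lamFun_coe, if_pos]
    have : a * (n - (x : ℕ)) ≤ a * n := Nat.mul_le_mul_left a (Nat.sub_le _ _)
    omega

theorem lt_width_iff (ha : 0 < a) (hb : 0 < b) (ε : ℕ) (x X : Fin (n + 1)) :
    ε < width n a b x X ↔ lamFun n a b ε (lamFun n a b ε x) ≤ X := by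
  constructor
  · intro h
    exact not_lt.1 (Nat.notMem_of_lt_sInf h)
  · intro h
    by_contra! hw
    have hne : {ε : ℕ | (X : WithTop (Fin (n + 1))) <
        lamFun n a b ε (lamFun n a b ε x)}.Nonempty :=
      ⟨a * n + b, by simp [lamFun_eq_top (a * n + b) le_rfl]⟩
    have hmem : (X : WithTop (Fin (n + 1))) < _ := Nat.sInf_mem hne
    exact absurd (hmem.trans_le ((lamFun_mono _ _ _ _ (lamFun_height_mono ha hb hw _)).trans
      (lamFun_height_mono ha hb hw _))) (not_lt.2 h)

/-- The endpoints of the interval representations with supports `[x, X]` and `[y, Y]` differ in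
position by at most `ε`. -/
def Close (n a b ε : ℕ) (x X y Y : Fin (n + 1)) : Prop :=
  pos n a b x ≤ pos n a b y + ε ∧ pos n a b y ≤ pos n a b x + ε ∧
    death n a b X ≤ death n a b Y + ε ∧ death n a b Y ≤ death n a b X + ε

theorem Close.symm {ε : ℕ} {x X y Y : Fin (n + 1)} (h : Close n a b ε x X y Y) :
    Close n a b ε y Y x X :=
  ⟨h.2.1, h.1, h.2.2.2, h.2.2.1⟩

end Positions

section Matchings

/-- Hall's theorem, with the marriage condition certified by a pair of matrices whose product is
triangular. -/
theorem exists_injective_of_triangular {K ι κ : Type*} [Field K] [Finite ι] [Fintype κ]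
    [DecidableEq ι] (R : ι → κ → Prop) (α : ι → ℕ) (c : ι → κ → K) (d : κ → ι → K)
    (hR : ∀ s t s', α s ≤ α s' → c s t ≠ 0 → d t s' ≠ 0 → R s t ∨ R s' t)
    (hcd : ∀ s s', α s ≤ α s' → ∑ t, c s t * d t s' = if s = s' then 1 else 0) :
    ∃ f : ι → κ, Function.Injective f ∧ ∀ s, R s (f s) := by
  classical
  have key := (Finset.all_card_le_biUnion_card_iff_exists_injective
    (fun s => Finset.univ.filter (R s))).1 ?_
  · obtain ⟨f, hf, h⟩ := key
    exact ⟨f, hf, fun s => by simpa using h s⟩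
  intro A
  set N := A.biUnion fun s => Finset.univ.filter (R s) with hN
  have hli : LinearIndependent K (fun (s : A) (t : N) => c s t) := by
    rw [Fintype.linearIndependent_iff]
    intro g hg
    by_contra! hne
    obtain ⟨s', hs', hmax⟩ := Finset.exists_max_image
      (Finset.univ.filter fun s => g s ≠ 0) (fun s => α s)
      (by obtain ⟨i, hi⟩ := hne; exact ⟨i, by simpa using hi⟩)
    simp only [Finset.mem_filter, Finset.mem_univ, true_and] at hs' hmax
    have h1 : ∀ t : N, ∑ s : A, g s * c s t = 0 := fun t => by
      simpa using congrFun hg t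
    have h2 : ∀ s : A, g s * ∑ t : N, c s t * d t s' = if s = s' then g s else 0 := by
      intro s
      by_cases hgs : g s = 0
      · simp [hgs]
      have hle := hmax s hgs
      have h3 : ∑ t : N, c s t * d t s' = ∑ t, c s t * d t s' := by
        rw [Finset.sum_coe_sort N (fun t => c s t * d t s')]
        refine Finset.sum_subset (Finset.subset_univ _) fun t _ ht => ?_
        by_contra h0
        rcases hR s t s' hle (left_ne_zero_of_mul h0) (right_ne_zero_of_mul h0) with h | h
        · exact ht (Finset.mem_biUnion.2 ⟨s, s.2, by simpa using h⟩)
        · exact ht (Finset.mem_biUnion.2 ⟨s', s'.2, by simpa using h⟩)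
      rw [h3, hcd s s' hle]
      by_cases hs : s = s' <;> simp [hs]
    have h4 : ∑ s : A, g s * ∑ t : N, c s t * d t s' = 0 := by
      simp_rw [Finset.mul_sum]
      rw [Finset.sum_comm]
      refine Finset.sum_eq_zero fun t _ => ?_
      simp_rw [← mul_assoc]
      rw [← Finset.sum_mul, h1, zero_mul]
    rw [Finset.sum_congr rfl fun s _ => h2 s] at h4
    simp only [Finset.sum_ite_eq', Finset.mem_univ, if_true] at h4
    exact hs' h4
  simpa using hli.fintype_card_le_finrank

variable {ι κ : Type*}

/-- The elements reached by alternating between `f` and `g` from an element of `A` outside the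
image of `g`. -/
inductive Alternating {A : Set ι} {B : Set κ} (f : A → κ) (g : B → ι) : A → Prop
  | base (s : A) (h : ∀ t, g t ≠ s) : Alternating f g s
  | step (s s' : A) (t : B) (ht : f s = t) (hs' : g t = s') (h : Alternating f g s) :
      Alternating f g s'

/-- Mendelsohn–Dulmage: matchings covering `A` on one side and `B` on the other combine into
one matching that covers both. -/
theorem exists_matching_covering {A : Set ι} {B : Set κ} {f : A → κ} {g : B → ι}
    (hf : Function.Injective f) (hg : Function.Injective g) :
    ∃ m : ι → κ → Prop,
      (∀ s t, m s t → (∃ h : s ∈ A, f ⟨s, h⟩ = t) ∨ ∃ h : t ∈ B, g ⟨t, h⟩ = s) ∧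
      (∀ s t t', m s t → m s t' → t = t') ∧ (∀ s s' t, m s t → m s' t → s = s') ∧
      (∀ s ∈ A, ∃ t, m s t) ∧ (∀ t ∈ B, ∃ s, m s t) := by
  have hnot : ∀ (t : B) (s : A), g t = s → Alternating f g s →
      ∃ s', Alternating f g s' ∧ f s' = t := by
    rintro t s hts (⟨_, h⟩ | ⟨s', _, t', ht', hs', h⟩)
    · exact absurd hts (h t)
    · exact ⟨s', h, by rw [ht', hg (hs'.trans hts.symm)]⟩
  refine ⟨fun s t => (∃ h : s ∈ A, f ⟨s, h⟩ = t ∧ Alternating f g ⟨s, h⟩) ∨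
    ∃ h : t ∈ B, g ⟨t, h⟩ = s ∧ ∀ s', Alternating f g s' → f s' ≠ t, ?_, ?_, ?_, ?_, ?_⟩
  · rintro s t (⟨h, h', -⟩ | ⟨h, h', -⟩)
    exacts [.inl ⟨h, h'⟩, .inr ⟨h, h'⟩]
  · rintro s t t' (⟨h, rfl, hs⟩ | ⟨h, rfl, hs⟩) (⟨h', h2, hs'⟩ | ⟨h', h2, hs'⟩)
    · exact h2
    · obtain ⟨s', h3, h4⟩ := hnot ⟨t', h'⟩ ⟨s, h⟩ h2 hs
      exact absurd h4 (hs' s' h3)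
    · obtain ⟨s', h3, h4⟩ := hnot ⟨t, h⟩ ⟨_, h'⟩ rfl hs'
      exact absurd h4 (hs s' h3)
    · exact congrArg Subtype.val (hg h2.symm)
  · rintro s s' t (⟨h, rfl, hs⟩ | ⟨h, rfl, hs⟩) (⟨h', h2, hs'⟩ | ⟨h', h2, hs'⟩)
    · exact congrArg Subtype.val (hf h2.symm)
    · exact absurd rfl (hs' _ hs)
    · exact absurd h2 (hs _ hs')
    · exact h2
  · intro s hs
    by_cases hz : Alternating f g ⟨s, hs⟩
    · exact ⟨_, .inl ⟨hs, rfl, hz⟩⟩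
    · by_cases hb : ∃ t, g t = s
      · obtain ⟨t, ht⟩ := hb
        refine ⟨t, .inr ⟨t.2, ht, fun s' hs' hst => hz (.step s' ⟨s, hs⟩ t hst ht hs')⟩⟩
      · exact absurd (.base _ fun t ht => hb ⟨t, ht⟩) hz
  · intro t ht
    by_cases hb : ∃ s', Alternating f g s' ∧ f s' = t
    · obtain ⟨s', h1, h2⟩ := hb
      exact ⟨s', .inl ⟨s'.2, h2, h1⟩⟩
    · exact ⟨_, .inr ⟨ht, rfl, fun s' h1 h2 => hb ⟨s', h1, h2⟩⟩⟩

end Matchings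

section DirectSums

variable {P : Type*} [Preorder P] {K : Type*} [Field K] {ι κ : Type*}

theorem Interleaved.symm {Λ Γ : Translation P} {F G : Rep P K} (h : Interleaved Λ Γ F G) :
    Interleaved Γ Λ G F := by
  obtain ⟨φ, ψ, h1, h2⟩ := h
  exact ⟨ψ, φ, h2, h1⟩

open Classical in
/-- The linear map of products built from linear maps between factors related by `m`. -/
noncomputable def matchMap {V : ι → Type*} {W : κ → Type*} [∀ i, AddCommGroup (V i)]
    [∀ i, Module K (V i)] [∀ j, AddCommGroup (W j)] [∀ j, Module K (W j)] {m : ι → κ → Prop}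
    (f : ∀ i j, m i j → V i →ₗ[K] W j) : (∀ i, V i) →ₗ[K] ∀ j, W j :=
  LinearMap.pi fun j => if h : ∃ i, m i j then
    (f _ j h.choose_spec).comp (LinearMap.proj h.choose) else 0

section

variable {V : ι → Type*} {W : κ → Type*} [∀ i, AddCommGroup (V i)]
  [∀ i, Module K (V i)] [∀ j, AddCommGroup (W j)] [∀ j, Module K (W j)] {m : ι → κ → Prop}
  (f : ∀ i j, m i j → V i →ₗ[K] W j) (v : ∀ i, V i)

theorem matchMap_apply_of_not_exists {j : κ} (h : ¬ ∃ i, m i j) : matchMap f v j = 0 := by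
  simp [matchMap, h]

theorem matchMap_apply (hm : ∀ i i' j, m i j → m i' j → i = i') {i : ι} {j : κ} (h : m i j) :
    matchMap f v j = f i j h (v i) := by
  have h' : ∃ i, m i j := ⟨i, h⟩
  have aux : ∀ i' (h' : m i' j), i' = i → f i' j h' (v i') = f i j h (v i) := by
    rintro i' h' rfl
    rfl
  rw [← aux _ h'.choose_spec (hm _ _ _ h'.choose_spec h)]
  simp [matchMap, h']

end

/-- The morphism of direct sums built from morphisms between summands related by `m`. -/
noncomputable def matchHom {Λ : Translation P} {F : ι → Rep P K} {G : κ → Rep P K}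
    {m : ι → κ → Prop} (hm : ∀ i i' j, m i j → m i' j → i = i')
    (φ : ∀ i j, m i j → RepHom (F i) ((G j).shift Λ)) :
    RepHom (Rep.dfsum F) ((Rep.dfsum G).shift Λ) where
  app p := matchMap (V := fun i => (F i).V p) (W := fun j => (G j).V (Λ.toFun p))
    fun i j h => (φ i j h).app p
  natural {p q} hpq := by
    apply LinearMap.ext
    intro v
    funext j
    let f₁ : ∀ i j, m i j → (F i).V p →ₗ[K] (G j).V (Λ.toFun p) := fun i j h => (φ i j h).app p
    let f₂ : ∀ i j, m i j → (F i).V q →ₗ[K] (G j).V (Λ.toFun q) := fun i j h => (φ i j h).app q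
    let w : ∀ i, (F i).V q := fun i => (F i).map hpq (v i)
    by_cases h : ∃ i, m i j
    · obtain ⟨i, h⟩ := h
      exact (congrArg ((G j).map (Λ.mono hpq)) (matchMap_apply f₁ v hm h)).trans
        ((LinearMap.congr_fun ((φ i j h).natural hpq) (v i)).trans
          (matchMap_apply f₂ w hm h).symm)
    · exact (congrArg ((G j).map (Λ.mono hpq)) (matchMap_apply_of_not_exists f₁ v h)).trans
        ((map_zero _).trans (matchMap_apply_of_not_exists f₂ w h).symm)

theorem matchHom_comp {Λ Γ : Translation P} {F : ι → Rep P K} {G : κ → Rep P K}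
    {m : ι → κ → Prop} (hl : ∀ i i' j, m i j → m i' j → i = i')
    (hr : ∀ j j' i, m i j → m i j' → j = j')
    {φ : ∀ i j, m i j → RepHom (F i) ((G j).shift Λ)}
    {ψ : ∀ j i, m i j → RepHom (G j) ((F i).shift Γ)}
    (hcomp : ∀ i j h p, ((ψ j i h).app (Λ.toFun p)).comp ((φ i j h).app p)
      = (F i).map ((Λ.le_apply p).trans (Γ.le_apply (Λ.toFun p))))
    (hzero : ∀ i, (¬ ∃ j, m i j) → ∀ p,
      (F i).map ((Λ.le_apply p).trans (Γ.le_apply (Λ.toFun p))) = 0) (p : P) :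
    ((matchHom (m := fun j i => m i j) hr ψ).app (Λ.toFun p)).comp ((matchHom hl φ).app p)
      = (Rep.dfsum F).map ((Λ.le_apply p).trans (Γ.le_apply (Λ.toFun p))) := by
  apply LinearMap.ext
  intro v
  funext i
  let f₁ : ∀ i j, m i j → (F i).V p →ₗ[K] (G j).V (Λ.toFun p) := fun i j h => (φ i j h).app p
  let f₂ : ∀ j i, m i j → (G j).V (Λ.toFun p) →ₗ[K] (F i).V (Γ.toFun (Λ.toFun p)) :=
    fun j i h => (ψ j i h).app (Λ.toFun p)
  by_cases h : ∃ j, m i j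
  · obtain ⟨j, h⟩ := h
    exact (matchMap_apply (m := fun j i => m i j) f₂ (matchMap f₁ v) hr h).trans
      ((congrArg ((ψ j i h).app (Λ.toFun p)) (matchMap_apply f₁ v hl h)).trans
        (LinearMap.congr_fun (hcomp i j h p) (v i)))
  · exact (matchMap_apply_of_not_exists (m := fun j i => m i j) f₂ (matchMap f₁ v) h).trans
      (LinearMap.congr_fun (hzero i h p) (v i)).symm

/-- Direct sums are interleaved if some summands are matched with interleaved ones and the
interleaving is trivial on the remaining ones. -/
theorem Interleaved.dfsum {Λ : Translation P} {F : ι → Rep P K} {G : κ → Rep P K}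
    {m : ι → κ → Prop} (hr : ∀ i j j', m i j → m i j' → j = j')
    (hl : ∀ i i' j, m i j → m i' j → i = i')
    (hm : ∀ i j, m i j → Interleaved Λ Λ (F i) (G j))
    (hF : ∀ i, (¬ ∃ j, m i j) → ∀ p,
      (F i).map ((Λ.le_apply p).trans (Λ.le_apply (Λ.toFun p))) = 0)
    (hG : ∀ j, (¬ ∃ i, m i j) → ∀ p,
      (G j).map ((Λ.le_apply p).trans (Λ.le_apply (Λ.toFun p))) = 0) :
    Interleaved Λ Λ (Rep.dfsum F) (Rep.dfsum G) := by
  choose φ ψ h using hm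
  have hr' : ∀ j j' i, m i j → m i j' → j = j' := fun j j' i => hr i j j'
  refine ⟨matchHom hl φ, matchHom (m := fun j i => m i j) hr' fun j i => ψ i j, ?_, ?_⟩
  · exact matchHom_comp hl hr' (fun i j hij => (h i j hij).1) hF
  · exact matchHom_comp (m := fun j i => m i j) hr' hl (fun j i hij => (h i j hij).2) hG

end DirectSums

section Bars

variable {Q : Type*} [LinearOrder Q] {K : Type*} [Field K]

/-- The canonical morphism from the interval representation on `[x, X]` to the shift of the one
on `[y, Y]`. -/
noncomputable def barHom (K : Type*) [Field K] {Λ : Translation Q} {x X y Y : Q}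
    (hlo : y ≤ Λ.toFun x) (hhi : ∀ p, Λ.toFun p ≤ Y → p ≤ X) :
    RepHom (barRep K x X) ((barRep K y Y).shift Λ) where
  app p := phiMap K (Set.Icc x X) (Set.Icc y Y) p (Λ.toFun p)
  natural {p q} hpq := by
    classical
    change (phiMap K (Set.Icc y Y) (Set.Icc y Y) (Λ.toFun p) (Λ.toFun q)).comp
      (phiMap K (Set.Icc x X) (Set.Icc y Y) p (Λ.toFun p)) =
      (phiMap K (Set.Icc x X) (Set.Icc y Y) q (Λ.toFun q)).comp
      (phiMap K (Set.Icc x X) (Set.Icc x X) p q)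
    apply LinearMap.ext
    intro v
    by_cases hp : p ∈ Set.Icc x X
    · apply Subtype.ext
      simp only [LinearMap.comp_apply, coe_phiMap]
      by_cases hq : Λ.toFun q ∈ Set.Icc y Y
      · have h1 : Λ.toFun p ∈ Set.Icc y Y :=
          ⟨hlo.trans (Λ.mono hp.1), (Λ.mono hpq).trans hq.2⟩
        have h2 : q ∈ Set.Icc x X := ⟨hp.1.trans hpq, hhi q hq.2⟩
        rw [if_pos hq, if_pos hq, if_pos h1, if_pos h2]
      · rw [if_neg hq, if_neg hq]
    · rw [eq_zero_of_notMem hp v, map_zero, map_zero]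

theorem barHom_comp {Λ Γ : Translation Q} {x X y Y : Q}
    (hlo : y ≤ Λ.toFun x) (hhi : ∀ p, Λ.toFun p ≤ Y → p ≤ X)
    (hlo' : x ≤ Γ.toFun y) (hhi' : ∀ p, Γ.toFun p ≤ X → p ≤ Y) (p : Q) :
    ((barHom K hlo' hhi').app (Λ.toFun p)).comp ((barHom K hlo hhi).app p) =
      (barRep K x X).map ((Λ.le_apply p).trans (Γ.le_apply (Λ.toFun p))) := by
  classical
  change (phiMap K (Set.Icc y Y) (Set.Icc x X) (Λ.toFun p) (Γ.toFun (Λ.toFun p))).comp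
    (phiMap K (Set.Icc x X) (Set.Icc y Y) p (Λ.toFun p)) =
    phiMap K (Set.Icc x X) (Set.Icc x X) p (Γ.toFun (Λ.toFun p))
  apply LinearMap.ext
  intro v
  by_cases hp : p ∈ Set.Icc x X
  · apply Subtype.ext
    simp only [LinearMap.comp_apply, coe_phiMap]
    by_cases hq : Γ.toFun (Λ.toFun p) ∈ Set.Icc x X
    · have h1 : Λ.toFun p ∈ Set.Icc y Y := ⟨hlo.trans (Λ.mono hp.1), hhi' _ hq.2⟩
      rw [if_pos hq, if_pos hq, if_pos h1]
    · rw [if_neg hq, if_neg hq]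
  · rw [eq_zero_of_notMem hp v, map_zero, map_zero]

theorem barRep_interleaved {Λ Γ : Translation Q} {x X y Y : Q}
    (hlo : y ≤ Λ.toFun x) (hhi : ∀ p, Λ.toFun p ≤ Y → p ≤ X)
    (hlo' : x ≤ Γ.toFun y) (hhi' : ∀ p, Γ.toFun p ≤ X → p ≤ Y) :
    Interleaved Λ Γ (barRep K x X) (barRep K y Y) :=
  ⟨barHom K hlo hhi, barHom K hlo' hhi', barHom_comp hlo hhi hlo' hhi',
    barHom_comp hlo' hhi' hlo hhi⟩

theorem barRep_map_eq_zero {Λ Γ : Translation Q} {x X : Q}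
    (h : ¬ Γ.toFun (Λ.toFun x) ≤ X) (p : Q) :
    (barRep K x X).map ((Λ.le_apply p).trans (Γ.le_apply (Λ.toFun p))) = 0 := by
  change phiMap K (Set.Icc x X) (Set.Icc x X) p (Γ.toFun (Λ.toFun p)) = 0
  exact phiMap_neg K fun hp => h ((Γ.mono (Λ.mono hp.1.1)).trans hp.2.2)

end Bars

section Isometry

variable {n a b : ℕ} {K : Type*} [Field K] {ι κ : Type*}
  {lo hi : ι → Fin (n + 1)} {lo' hi' : κ → Fin (n + 1)} {ε : ℕ}

theorem Close.interleaved (ha : 0 < a) (hb : 0 < b) {x X y Y : Fin (n + 1)}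
    (h : Close n a b ε x X y Y) :
    Interleaved (lamTrans n a b ε) (lamTrans n a b ε)
      (intervalRep n K x X) (intervalRep n K y Y) := by
  obtain ⟨h1, h2, h3, h4⟩ := h
  refine barRep_interleaved ((le_lamFun_iff ha hb _ _ _).2 h2) ?_
    ((le_lamFun_iff ha hb _ _ _).2 h1) ?_ <;> intro p hp <;>
  · have := (lamFun_le_iff ha hb _ _ _).1 hp
    exact (pos_lt_death_iff ha hb _ _).1 (by omega)

theorem IsMatching.interleaved (ha : 0 < a) (hb : 0 < b)
    (h : IsMatching n a b ε K lo hi lo' hi') :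
    Interleaved (lamTrans n a b ε) (lamTrans n a b ε)
        (Rep.dfsum fun i => intervalRep n K (lo i) (hi i))
        (Rep.dfsum fun j => intervalRep n K (lo' j) (hi' j)) := by
  obtain ⟨S, T, f, hf, hS, hT, hm⟩ := h
  refine Interleaved.dfsum (m := fun s t => ∃ h : s ∈ S, (f ⟨s, h⟩ : κ) = t) ?_ ?_ ?_ ?_ ?_
  · rintro s _ _ ⟨_, rfl⟩ ⟨_, rfl⟩
    rfl
  · rintro s s' _ ⟨h, rfl⟩ ⟨h', e⟩
    exact congrArg Subtype.val (hf.1 (Subtype.ext e.symm))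
  · rintro s _ ⟨h, rfl⟩
    exact hm ⟨s, h⟩
  · intro s hs p
    exact barRep_map_eq_zero (Λ := lamTrans n a b ε) (Γ := lamTrans n a b ε)
      (fun hle => hs ⟨_, hS s ((lt_width_iff ha hb _ _ _).2 hle), rfl⟩) p
  · intro t ht p
    refine barRep_map_eq_zero (Λ := lamTrans n a b ε) (Γ := lamTrans n a b ε)
      (fun hle => ht ?_) p
    obtain ⟨s, hs⟩ := hf.2 ⟨t, hT t ((lt_width_iff ha hb _ _ _).2 hle)⟩
    exact ⟨s, s.2, by rw [hs]⟩

theorem RepHom.coeff_bounds (ha : 0 < a) (hb : 0 < b) (hlo : ∀ i, lo i ≤ hi i)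
    (f : RepHom (Rep.dfsum fun i => intervalRep n K (lo i) (hi i))
      ((Rep.dfsum fun j => intervalRep n K (lo' j) (hi' j)).shift (lamTrans n a b ε)))
    {i : ι} {j : κ}
    (h : RepHom.coeff (fun i => WithTop.coe_le_coe.2 (hlo i)) f i j ≠ 0) :
    pos n a b (lo' j) ≤ pos n a b (lo i) + ε ∧
      death n a b (hi' j) ≤ death n a b (hi i) + ε := by
  refine ⟨(le_lamFun_iff ha hb _ _ _).1 (RepHom.mem_Icc_of_coeff_ne_zero _ _ h).1, ?_⟩
  have h1 := RepHom.hi_lt_of_coeff_ne_zero _ f h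
    (q := Order.succ (hi i : WithTop (Fin (n + 1)))) (Order.lt_succ_of_not_isMax (by simp))
  by_contra! h2
  exact absurd ((lamFun_le_iff ha hb _ _ _).2 h2) (not_le.2 h1)

theorem Interleaved.exists_injective (ha : 0 < a) (hb : 0 < b) [Finite ι] [Finite κ]
    (hlo : ∀ i, lo i ≤ hi i) (hlo' : ∀ j, lo' j ≤ hi' j)
    (h : Interleaved (lamTrans n a b ε) (lamTrans n a b ε)
        (Rep.dfsum fun i => intervalRep n K (lo i) (hi i))
        (Rep.dfsum fun j => intervalRep n K (lo' j) (hi' j))) :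
    ∃ f : {i | ε < width n a b (lo i) (hi i)} → κ, Function.Injective f ∧
      ∀ s : {i | ε < width n a b (lo i) (hi i)},
        Close n a b ε (lo s) (hi s) (lo' (f s)) (hi' (f s)) := by
  classical
  have := Fintype.ofFinite κ
  obtain ⟨φ, ψ, hφψ⟩ := h
  have hi₁ : ∀ i, (lo i : WithTop (Fin (n + 1))) ≤ hi i := fun i => WithTop.coe_le_coe.2 (hlo i)
  have hi₂ : ∀ j, (lo' j : WithTop (Fin (n + 1))) ≤ hi' j :=
    fun j => WithTop.coe_le_coe.2 (hlo' j)
  refine exists_injective_of_triangular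
    (fun s : {i | ε < width n a b (lo i) (hi i)} => fun t =>
      Close n a b ε (lo s) (hi s) (lo' t) (hi' t))
    (fun s => pos n a b (lo s) + death n a b (hi s))
    (fun s t => RepHom.coeff hi₁ φ s t) (fun t s => RepHom.coeff hi₂ ψ t s) ?_ ?_
  · intro s t s' hs h1 h2
    have b1 := RepHom.coeff_bounds ha hb hlo φ h1
    have b2 := RepHom.coeff_bounds ha hb hlo' ψ h2
    unfold Close
    omega
  · intro s s' hs
    have e1 := (lt_width_iff ha hb _ _ _).1 s.2
    have e2 := (lt_width_iff ha hb _ _ _).1 s'.2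
    have key : lamFun n a b ε (lamFun n a b ε (lo s)) ≤ hi s' := by
      by_cases hd : death n a b (hi s) ≤ death n a b (hi s')
      · rw [lamFun_le_iff ha hb] at e1 ⊢
        omega
      · refine le_trans (lamFun_mono _ _ _ _ (lamFun_mono _ _ _ _ ?_)) e2
        exact (pos_strictMono ha hb).le_iff_le.1 (by omega)
    have := IsInterleaving.sum_coeff_mul_coeff hi₁ φ hi₂ hφψ key
    simpa only [Subtype.ext_iff] using this

theorem Interleaved.isMatching (ha : 0 < a) (hb : 0 < b) [Finite ι] [Finite κ]
    (hlo : ∀ i, lo i ≤ hi i) (hlo' : ∀ j, lo' j ≤ hi' j)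
    (h : Interleaved (lamTrans n a b ε) (lamTrans n a b ε)
        (Rep.dfsum fun i => intervalRep n K (lo i) (hi i))
        (Rep.dfsum fun j => intervalRep n K (lo' j) (hi' j))) :
    IsMatching n a b ε K lo hi lo' hi' := by
  obtain ⟨f, hf, hfc⟩ := h.exists_injective ha hb hlo hlo'
  obtain ⟨g, hg, hgc⟩ := h.symm.exists_injective ha hb hlo' hlo
  obtain ⟨m, hm, hr, hl, hA, hB⟩ := exists_matching_covering hf hg
  have hclose : ∀ s t, m s t → Close n a b ε (lo s) (hi s) (lo' t) (hi' t) := by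
    intro s t hst
    obtain ⟨hs, rfl⟩ | ⟨ht, rfl⟩ := hm s t hst
    exacts [hfc ⟨s, hs⟩, (hgc ⟨t, ht⟩).symm]
  choose F hF using fun s : {s | ∃ t, m s t} => s.2
  refine ⟨{s | ∃ t, m s t}, {t | ∃ s, m s t}, fun s => ⟨F s, s, hF s⟩, ⟨?_, ?_⟩, hA, hB,
    fun s => (hclose _ _ (hF s)).interleaved ha hb⟩
  · intro s s' hs
    have hs : F s = F s' := congrArg Subtype.val hs
    exact Subtype.ext (hl _ _ _ (hF s) (hs ▸ hF s'))
  · rintro ⟨t, s, hst⟩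
    exact ⟨⟨s, t, hst⟩, Subtype.ext (hr _ _ _ (hF ⟨s, t, hst⟩) hst)⟩

theorem isMatching_of_le (ha : 0 < a) (hb : 0 < b) (hε : a * n + b ≤ ε) :
    IsMatching n a b ε K lo hi lo' hi' := by
  have hw : ∀ x X : Fin (n + 1), ¬ ε < width n a b x X := fun x X h => by
    simp [lt_width_iff ha hb, lamFun_eq_top ε hε] at h
  exact ⟨∅, ∅, fun s => s.2.elim, ⟨fun s => s.2.elim, fun t => t.2.elim⟩,
    fun s h => absurd h (hw _ _), fun t h => absurd h (hw _ _), fun s => s.2.elim⟩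

end Isometry

/-- (Isometry theorem for finite totally ordered sets.)  For finite
direct sums `I`, `M` of convex representations of `{0, …, n}`, the interleaving
distance `D(I,M) = min {ε | I and M are (Λ_ε,Λ_ε)-interleaved}` equals the bottleneck
distance `D_B(I,M) = min {ε | there is an ε-matching between I and M}`; both defining
sets are nonempty. -/
theorem statement19 (n a b : ℕ) (ha : 0 < a) (hb : 0 < b) {K : Type*} [Field K]
    {ι κ : Type*} [Finite ι] [Finite κ]
    (lo hi : ι → Fin (n + 1)) (hIok : ∀ i, lo i ≤ hi i)
    (lo' hi' : κ → Fin (n + 1)) (hMok : ∀ j, lo' j ≤ hi' j) :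
    {ε : ℕ | Interleaved (lamTrans n a b ε) (lamTrans n a b ε)
        (Rep.dfsum fun i => intervalRep n K (lo i) (hi i))
        (Rep.dfsum fun j => intervalRep n K (lo' j) (hi' j))}.Nonempty ∧
    {ε : ℕ | IsMatching n a b ε K lo hi lo' hi'}.Nonempty ∧
    sInf {ε : ℕ | Interleaved (lamTrans n a b ε) (lamTrans n a b ε)
        (Rep.dfsum fun i => intervalRep n K (lo i) (hi i))
        (Rep.dfsum fun j => intervalRep n K (lo' j) (hi' j))} =
      sInf {ε : ℕ | IsMatching n a b ε K lo hi lo' hi'} := by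
  have hset : {ε : ℕ | Interleaved (lamTrans n a b ε) (lamTrans n a b ε)
        (Rep.dfsum fun i => intervalRep n K (lo i) (hi i))
        (Rep.dfsum fun j => intervalRep n K (lo' j) (hi' j))} =
      {ε : ℕ | IsMatching n a b ε K lo hi lo' hi'} :=
    Set.ext fun ε => ⟨fun h => Interleaved.isMatching ha hb hIok hMok h,
      fun h => IsMatching.interleaved ha hb h⟩
  have hne : {ε : ℕ | IsMatching n a b ε K lo hi lo' hi'}.Nonempty :=
    ⟨a * n + b, isMatching_of_le ha hb le_rfl⟩
  rw [hset]
  exact ⟨hne, hne, rfl⟩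

end GPM
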